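/- Let E₁ and E₂ be Banach spaces over 𝕜, let 𝒜₁ ⊆ B(E₁) and 𝒜₂ ⊆ B(E₂) be standard subalgebras, and let T : 𝒜₁ → 𝒜₂ be a biseparating linear bijection. Then there exist a linear bijection S : E₁ → E₂ and a linear bijection Ψ : E₁* → E₂* between the continuous dual spaces (S and Ψ are plain linear maps, not assumed continuous) such that T(e ⊗ e*) = S(e) ⊗ Ψ(e*) for all e ∈ E₁ and all e* ∈ E₁*. -/

import Mathlib

set_option synthInstance.maxHeartbeats 400000
set_option maxHeartbeats 1000000

/-- A subalgebra of `B(E)` is *standard* if it contains every continuous finite-rank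
operator (it contains the identity automatically, being a subalgebra). -/
def IsStandardSubalgebra (𝕜 : Type*) [RCLike 𝕜] {E : Type*} [NormedAddCommGroup E]
    [NormedSpace 𝕜 E] (𝒜 : Subalgebra 𝕜 (E →L[𝕜] E)) : Prop :=
  ∀ A : E →L[𝕜] E, FiniteDimensional 𝕜 (LinearMap.range (A : E →ₗ[𝕜] E)) → A ∈ 𝒜

/-- The rank-one operator `e ⊗ e*` sending `e'` to `e*(e') • e`. -/
noncomputable def rankOne {𝕜 : Type*} [RCLike 𝕜] {E : Type*} [NormedAddCommGroup E]
    [NormedSpace 𝕜 E] (e : E) (f : E →L[𝕜] 𝕜) : E →L[𝕜] E :=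
  f.smulRight e


section Helpers

variable {𝕜 : Type*} [RCLike 𝕜] {E : Type*} [NormedAddCommGroup E] [NormedSpace 𝕜 E]

theorem rankOne_mem {𝒜 : Subalgebra 𝕜 (E →L[𝕜] E)} (h : IsStandardSubalgebra 𝕜 𝒜)
    (e : E) (f : E →L[𝕜] 𝕜) : rankOne e f ∈ 𝒜 := by
  apply h
  refine Submodule.finiteDimensional_of_le (S₂ := Submodule.span 𝕜 {e}) ?_
  rintro _ ⟨x, rfl⟩
  exact Submodule.mem_span_singleton.2 ⟨f x, rfl⟩

/-- rank one operator as an element of the algebra -/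
noncomputable def rk {𝒜 : Subalgebra 𝕜 (E →L[𝕜] E)} (h : IsStandardSubalgebra 𝕜 𝒜)
    (e : E) (f : E →L[𝕜] 𝕜) : 𝒜 := ⟨rankOne e f, rankOne_mem h e f⟩

theorem rk_apply {𝒜 : Subalgebra 𝕜 (E →L[𝕜] E)} (h : IsStandardSubalgebra 𝕜 𝒜)
    (e : E) (f : E →L[𝕜] 𝕜) (x : E) : (rk h e f : E →L[𝕜] E) x = f x • e := rfl

theorem alg_ext {𝒜 : Subalgebra 𝕜 (E →L[𝕜] E)} {a b : 𝒜}
    (h : ∀ x, (a : E →L[𝕜] E) x = (b : E →L[𝕜] E) x) : a = b :=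
  Subtype.ext (ContinuousLinearMap.ext h)

/-- containment of right annihilators -/
def KR {A : Type*} [Ring A] (a c : A) : Prop := ∀ b, a * b = 0 → c * b = 0

/-- containment of left annihilators -/
def LR {A : Type*} [Ring A] (a c : A) : Prop := ∀ b, b * a = 0 → b * c = 0

/-- abstract rank one -/
def R1 {A : Type*} [Ring A] (a : A) : Prop := a ≠ 0 ∧ ∀ c, c ≠ 0 → KR a c → KR c a

variable {𝒜 : Subalgebra 𝕜 (E →L[𝕜] E)} (h : IsStandardSubalgebra 𝕜 𝒜)

theorem exists_one {f : E →L[𝕜] 𝕜} (hf : f ≠ 0) : ∃ u, f u = 1 := by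
  obtain ⟨x, hx⟩ : ∃ x, f x ≠ 0 := by
    by_contra! hh
    exact hf (ContinuousLinearMap.ext hh)
  exact ⟨(f x)⁻¹ • x, by simp [hx]⟩

theorem exists_dual_one {e : E} (he : e ≠ 0) : ∃ g : E →L[𝕜] 𝕜, g e = 1 := by
  obtain ⟨g, hg⟩ := SeparatingDual.exists_eq_one (R := 𝕜) he
  exact ⟨g, hg⟩

theorem rk_ne_zero {e : E} {f : E →L[𝕜] 𝕜} (he : e ≠ 0) (hf : f ≠ 0) : rk h e f ≠ 0 := by
  obtain ⟨u, hu⟩ := exists_one hf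
  intro hh
  have := rk_apply h e f u
  rw [hh, hu] at this
  exact he (by simpa using this.symm)

theorem KR_rk {e e' : E} (f : E →L[𝕜] 𝕜) (he : e ≠ 0) : KR (rk h e f) (rk h e' f) := by
  intro b hb
  apply alg_ext
  intro x
  have h1 : ((rk h e f * b : 𝒜) : E →L[𝕜] E) x = 0 := by rw [hb]; rfl
  have h2 : f ((b : E →L[𝕜] E) x) • e = 0 := h1
  have h3 : f ((b : E →L[𝕜] E) x) = 0 := (smul_eq_zero.1 h2).resolve_right he
  change f ((b : E →L[𝕜] E) x) • e' = 0
  rw [h3, zero_smul]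

theorem LR_rk {e : E} {f f' : E →L[𝕜] 𝕜} (hf : f ≠ 0) : LR (rk h e f) (rk h e f') := by
  intro b hb
  obtain ⟨u, hu⟩ := exists_one hf
  apply alg_ext
  intro x
  have h1 : ((b * rk h e f : 𝒜) : E →L[𝕜] E) u = 0 := by rw [hb]; rfl
  have h2 : (b : E →L[𝕜] E) (f u • e) = 0 := h1
  change (b : E →L[𝕜] E) (f' x • e) = 0
  rw [hu, one_smul] at h2
  rw [map_smul, h2, smul_zero]

theorem KR_out {e : E} {f : E →L[𝕜] 𝕜} {c : 𝒜} (hk : KR (rk h e f) c) :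
    ∃ x, c = rk h x f := by
  by_cases hf : f = 0
  · refine ⟨0, ?_⟩
    have := hk 1 (alg_ext fun x => by
      change f x • e = 0
      simp [hf])
    rw [mul_one] at this
    rw [this]
    exact alg_ext fun x => by simp [rk_apply]
  obtain ⟨u, hu⟩ := exists_one hf
  refine ⟨(c : E →L[𝕜] E) u, ?_⟩
  have := hk (1 - rk h u f) (alg_ext fun x => by
    change f (x - f x • u) • e = 0
    simp [hu])
  apply alg_ext
  intro x
  have h1 : ((c * (1 - rk h u f) : 𝒜) : E →L[𝕜] E) x = 0 := by rw [this]; rfl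
  have h2 : (c : E →L[𝕜] E) (x - f x • u) = 0 := h1
  rw [map_sub, map_smul, sub_eq_zero] at h2
  rw [h2, rk_apply]

theorem LR_out {e : E} {f : E →L[𝕜] 𝕜} {c : 𝒜} (hk : LR (rk h e f) c) :
    ∃ g, c = rk h e g := by
  by_cases he : e = 0
  · refine ⟨0, ?_⟩
    have := hk 1 (alg_ext fun x => by
      change f x • e = 0
      simp [he])
    rw [one_mul] at this
    rw [this]
    exact alg_ext fun x => by simp [rk_apply]
  obtain ⟨g, hg⟩ := exists_dual_one (𝕜 := 𝕜) he
  refine ⟨g.comp (c : E →L[𝕜] E), ?_⟩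
  have := hk (1 - rk h e g) (alg_ext fun x => by
    change f x • e - g (f x • e) • e = 0
    simp [hg])
  apply alg_ext
  intro x
  have h1 : (((1 - rk h e g) * c : 𝒜) : E →L[𝕜] E) x = 0 := by rw [this]; rfl
  have h2 : (c : E →L[𝕜] E) x - g ((c : E →L[𝕜] E) x) • e = 0 := h1
  rw [sub_eq_zero] at h2
  exact h2

theorem R1_rk {e : E} {f : E →L[𝕜] 𝕜} (he : e ≠ 0) (hf : f ≠ 0) : R1 (rk h e f) := by
  refine ⟨rk_ne_zero h he hf, fun c hc hk => ?_⟩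
  obtain ⟨x, rfl⟩ := KR_out h hk
  refine KR_rk h f ?_
  rintro rfl
  exact hc (alg_ext fun x => by simp [rk_apply])

theorem R1_out {a : 𝒜} (ha : R1 a) : ∃ e f, e ≠ 0 ∧ f ≠ 0 ∧ a = rk h e f := by
  obtain ⟨ha0, hm⟩ := ha
  obtain ⟨x, hx⟩ : ∃ x, (a : E →L[𝕜] E) x ≠ 0 := by
    by_contra! hh
    exact ha0 (alg_ext hh)
  obtain ⟨g, hg⟩ := exists_dual_one (𝕜 := 𝕜) hx
  have hgne : g.comp (a : E →L[𝕜] E) ≠ 0 := by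
    intro hh
    have h1 : (g.comp (a : E →L[𝕜] E)) x = 0 := by rw [hh]; rfl
    have h2 : g ((a : E →L[𝕜] E) x) = 0 := h1
    rw [hg] at h2
    exact one_ne_zero h2
  have hc : rk h ((a : E →L[𝕜] E) x) g * a = rk h ((a : E →L[𝕜] E) x) (g.comp (a : E →L[𝕜] E)) :=
    rfl
  have hk : KR a (rk h ((a : E →L[𝕜] E) x) (g.comp (a : E →L[𝕜] E))) := by
    intro b hb
    rw [← hc, mul_assoc, hb, mul_zero]
  obtain ⟨y, hy⟩ := KR_out h (hm _ (rk_ne_zero h hx hgne) hk)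
  refine ⟨y, _, ?_, hgne, hy⟩
  rintro rfl
  apply ha0
  rw [hy]
  exact alg_ext fun x => by simp [rk_apply]

theorem rk_add_left (e e' : E) (f : E →L[𝕜] 𝕜) : rk h (e + e') f = rk h e f + rk h e' f :=
  alg_ext fun x => by
    change f x • (e + e') = f x • e + f x • e'
    rw [smul_add]

theorem rk_smul_left (c : 𝕜) (e : E) (f : E →L[𝕜] 𝕜) : rk h (c • e) f = c • rk h e f :=
  alg_ext fun x => by
    change f x • (c • e) = c • (f x • e)
    rw [smul_comm]

theorem rk_add_right (e : E) (f f' : E →L[𝕜] 𝕜) : rk h e (f + f') = rk h e f + rk h e f' :=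
  alg_ext fun x => by
    change (f x + f' x) • e = f x • e + f' x • e
    rw [add_smul]

theorem rk_smul_right (c : 𝕜) (e : E) (f : E →L[𝕜] 𝕜) : rk h e (c • f) = c • rk h e f :=
  alg_ext fun x => by
    change (c • f x) • e = c • (f x • e)
    rw [smul_assoc]

theorem rk_inj_left {e e' : E} {f : E →L[𝕜] 𝕜} (hf : f ≠ 0) (hh : rk h e f = rk h e' f) :
    e = e' := by
  obtain ⟨u, hu⟩ := exists_one hf
  have := rk_apply h e f u
  rw [hh, rk_apply, hu, one_smul, one_smul] at this
  exact this.symm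

theorem rk_inj_right {e : E} {f f' : E →L[𝕜] 𝕜} (he : e ≠ 0) (hh : rk h e f = rk h e f') :
    f = f' := by
  ext x
  have := rk_apply h e f x
  rw [hh, rk_apply] at this
  exact (smul_left_injective 𝕜 he this).symm

end Helpers

theorem biseparating_acts_on_rank_one_operators
    {𝕜 : Type*} [RCLike 𝕜]
    {E₁ E₂ : Type*} [NormedAddCommGroup E₁] [NormedSpace 𝕜 E₁] [CompleteSpace E₁]
    [NormedAddCommGroup E₂] [NormedSpace 𝕜 E₂] [CompleteSpace E₂]
    (𝒜₁ : Subalgebra 𝕜 (E₁ →L[𝕜] E₁)) (𝒜₂ : Subalgebra 𝕜 (E₂ →L[𝕜] E₂))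
    (h𝒜₁ : IsStandardSubalgebra 𝕜 𝒜₁) (h𝒜₂ : IsStandardSubalgebra 𝕜 𝒜₂)
    (T : 𝒜₁ →ₗ[𝕜] 𝒜₂) (hbij : Function.Bijective T)
    (hsep : ∀ a b : 𝒜₁, a * b = 0 → T a * T b = 0)
    (hsep' : ∀ a b : 𝒜₁, T a * T b = 0 → a * b = 0) :
    ∃ (S : E₁ →ₗ[𝕜] E₂) (Ψ : (E₁ →L[𝕜] 𝕜) →ₗ[𝕜] (E₂ →L[𝕜] 𝕜)),
      Function.Bijective S ∧ Function.Bijective Ψ ∧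
        ∀ (e : E₁) (f : E₁ →L[𝕜] 𝕜) (h : rankOne e f ∈ 𝒜₁),
          ((T ⟨rankOne e f, h⟩ : E₂ →L[𝕜] E₂)) = rankOne (S e) (Ψ f) := by
  classical
  rcases subsingleton_or_nontrivial E₁ with hE | hE
  · have hA : Subsingleton 𝒜₁ := ⟨fun a b => alg_ext fun x => Subsingleton.elim _ _⟩
    have h10 : (1 : 𝒜₂) = 0 := by
      obtain ⟨a, ha⟩ := hbij.2 1
      rw [← ha, Subsingleton.elim a 0, map_zero]
    have hz : ∀ x : E₂, x = 0 := fun x => by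
      have : ((1 : 𝒜₂) : E₂ →L[𝕜] E₂) x = 0 := by rw [h10]; rfl
      exact this
    have hE2 : Subsingleton E₂ := ⟨fun x y => (hz x).trans (hz y).symm⟩
    have hD1 : Subsingleton (E₁ →L[𝕜] 𝕜) :=
      ⟨fun f g => ContinuousLinearMap.ext fun x => by
        rw [Subsingleton.elim x 0, map_zero, map_zero]⟩
    have hD2 : Subsingleton (E₂ →L[𝕜] 𝕜) :=
      ⟨fun f g => ContinuousLinearMap.ext fun x => by
        rw [Subsingleton.elim x 0, map_zero, map_zero]⟩
    exact ⟨0, 0, ⟨fun _ _ _ => Subsingleton.elim _ _, fun _ => ⟨0, Subsingleton.elim _ _⟩⟩,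
      ⟨fun _ _ _ => Subsingleton.elim _ _, fun _ => ⟨0, Subsingleton.elim _ _⟩⟩,
      fun e f h => ContinuousLinearMap.ext fun x => Subsingleton.elim _ _⟩
  have hT0 : ∀ a, T a = 0 ↔ a = 0 := fun a => by
    constructor
    · intro hh
      exact hbij.1 (by rw [hh, map_zero])
    · rintro rfl
      exact map_zero T
  have hKR : ∀ a c, KR (T a) (T c) ↔ KR a c := by
    intro a c
    constructor
    · intro hk b hb
      exact hsep' _ _ (hk _ (hsep _ _ hb))
    · intro hk b hb
      obtain ⟨b, rfl⟩ := hbij.2 b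
      exact hsep _ _ (hk _ (hsep' _ _ hb))
  have hLR : ∀ a c, LR (T a) (T c) ↔ LR a c := by
    intro a c
    constructor
    · intro hk b hb
      exact hsep' _ _ (hk _ (hsep _ _ hb))
    · intro hk b hb
      obtain ⟨b, rfl⟩ := hbij.2 b
      exact hsep _ _ (hk _ (hsep' _ _ hb))
  have hR1 : ∀ a, R1 a → R1 (T a) := by
    rintro a ⟨ha, hm⟩
    refine ⟨fun hh => ha ((hT0 a).1 hh), fun c hc hk => ?_⟩
    obtain ⟨c, rfl⟩ := hbij.2 c
    rw [hKR] at hk ⊢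
    exact hm c (fun hh => hc ((hT0 c).2 hh)) hk
  obtain ⟨e0, he0⟩ := exists_ne (0 : E₁)
  obtain ⟨f0, hf0e⟩ := exists_dual_one (𝕜 := 𝕜) he0
  have hf0 : f0 ≠ 0 := by
    rintro rfl
    simp at hf0e
  obtain ⟨s0, p0, hs0, hp0, h00⟩ := R1_out h𝒜₂ (hR1 _ (R1_rk h𝒜₁ he0 hf0))
  have hSex : ∀ e, ∃ s, T (rk h𝒜₁ e f0) = rk h𝒜₂ s p0 := fun e => by
    apply KR_out h𝒜₂ (e := s0)
    rw [← h00, hKR]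
    exact KR_rk h𝒜₁ f0 he0
  have hPex : ∀ f, ∃ p, T (rk h𝒜₁ e0 f) = rk h𝒜₂ s0 p := fun f => by
    apply LR_out h𝒜₂ (f := p0)
    rw [← h00, hLR]
    exact LR_rk h𝒜₁ hf0
  choose S hS using hSex
  choose P hP using hPex
  have hSadd : ∀ x y, S (x + y) = S x + S y := fun x y => by
    apply rk_inj_left h𝒜₂ hp0
    rw [← hS, rk_add_left, map_add, rk_add_left, hS, hS]
  have hSsmul : ∀ (c : 𝕜) x, S (c • x) = c • S x := fun c x => by
    apply rk_inj_left h𝒜₂ hp0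
    rw [← hS, rk_smul_left, map_smul, rk_smul_left, hS]
  have hPadd : ∀ x y, P (x + y) = P x + P y := fun x y => by
    apply rk_inj_right h𝒜₂ hs0
    rw [← hP, rk_add_right, map_add, rk_add_right, hP, hP]
  have hPsmul : ∀ (c : 𝕜) x, P (c • x) = c • P x := fun c x => by
    apply rk_inj_right h𝒜₂ hs0
    rw [← hP, rk_smul_right, map_smul, rk_smul_right, hP]
  have hSinj : Function.Injective S := fun x y hxy => by
    apply rk_inj_left h𝒜₁ hf0
    apply hbij.1
    rw [hS, hS, hxy]
  have hPinj : Function.Injective P := fun x y hxy => by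
    apply rk_inj_right h𝒜₁ he0
    apply hbij.1
    rw [hP, hP, hxy]
  have hSsurj : Function.Surjective S := fun y => by
    obtain ⟨a, ha⟩ := hbij.2 (rk h𝒜₂ y p0)
    have hk : KR (rk h𝒜₁ e0 f0) a := by
      rw [← hKR, h00, ha]
      exact KR_rk h𝒜₂ p0 hs0
    obtain ⟨x, rfl⟩ := KR_out h𝒜₁ hk
    exact ⟨x, rk_inj_left h𝒜₂ hp0 (by rw [← hS, ha])⟩
  have hPsurj : Function.Surjective P := fun y => by
    obtain ⟨a, ha⟩ := hbij.2 (rk h𝒜₂ s0 y)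
    have hk : LR (rk h𝒜₁ e0 f0) a := by
      rw [← hLR, h00, ha]
      exact LR_rk h𝒜₂ hp0
    obtain ⟨x, rfl⟩ := LR_out h𝒜₁ hk
    exact ⟨x, rk_inj_right h𝒜₂ hs0 (by rw [← hP, ha])⟩
  have hSe0 : S e0 = s0 := rk_inj_left h𝒜₂ hp0 (by rw [← hS, h00])
  have hP0 : P 0 = 0 := by
    have h1 := hPadd 0 0
    rw [add_zero] at h1
    exact left_eq_add.1 h1
  have hlam : ∀ e f, f ≠ 0 → ∃ l : 𝕜, T (rk h𝒜₁ e f) = rk h𝒜₂ (l • S e) (P f) := by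
    intro e f hf
    have hPf : P f ≠ 0 := fun hh => hf (hPinj (hh.trans hP0.symm))
    obtain ⟨x, hx⟩ : ∃ x, T (rk h𝒜₁ e f) = rk h𝒜₂ x (P f) := by
      apply KR_out h𝒜₂ (e := s0)
      rw [← hP, hKR]
      exact KR_rk h𝒜₁ f he0
    obtain ⟨g, hg⟩ : ∃ g, T (rk h𝒜₁ e f) = rk h𝒜₂ (S e) g := by
      apply LR_out h𝒜₂ (f := p0)
      rw [← hS, hLR]
      exact LR_rk h𝒜₁ hf0
    obtain ⟨u, hu⟩ := exists_one hPf
    have h1 := rk_apply h𝒜₂ x (P f) u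
    rw [← hx, hg, rk_apply, hu, one_smul] at h1
    exact ⟨g u, by rw [hx, h1]⟩
  have hmain : ∀ e f, T (rk h𝒜₁ e f) = rk h𝒜₂ (S e) (P f) := by
    intro e f
    by_cases hf : f = 0
    · subst hf
      rw [hP0]
      have h1 : rk h𝒜₁ e 0 = 0 := alg_ext fun x => by simp [rk_apply]
      have h2 : rk h𝒜₂ (S e) 0 = 0 := alg_ext fun x => by simp [rk_apply]
      rw [h1, h2, map_zero]
    have hPf : P f ≠ 0 := fun hh => hf (hPinj (hh.trans hP0.symm))
    obtain ⟨l, hl⟩ := hlam e f hf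
    obtain ⟨m, hm⟩ := hlam (e + e0) f hf
    have h1 : l • S e + s0 = m • (S e + s0) := by
      apply rk_inj_left h𝒜₂ hPf
      rw [rk_add_left, ← hl, ← hP, ← map_add, ← rk_add_left, hm, hSadd, hSe0]
    by_cases hlm : l = m
    · subst hlm
      rw [smul_add] at h1
      have h2 : s0 = l • s0 := add_left_cancel h1
      have h3 : (1 : 𝕜) = l := smul_left_injective 𝕜 hs0 (by simpa using h2)
      rw [hl, ← h3, one_smul]
    · have hne : l - m ≠ 0 := sub_ne_zero.2 hlm
      have h2 : (l - m) • S e = (m - 1) • s0 := by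
        rw [sub_smul, sub_smul, one_smul, sub_eq_sub_iff_add_eq_add, h1, smul_add, add_comm]
      have h3 : (l - m) • e = (m - 1) • e0 := hSinj (by rw [hSsmul, hSsmul, hSe0, h2])
      have h4 : e = ((l - m)⁻¹ * (m - 1)) • e0 := by
        rw [mul_smul, ← h3, smul_smul, inv_mul_cancel₀ hne, one_smul]
      rw [h4, rk_smul_left, map_smul, hSsmul, hSe0, hP, rk_smul_left]
  exact ⟨{ toFun := S, map_add' := hSadd, map_smul' := hSsmul },
    { toFun := P, map_add' := hPadd, map_smul' := hPsmul },
    ⟨hSinj, hSsurj⟩, ⟨hPinj, hPsurj⟩, fun e f h => congrArg Subtype.val (hmain e f)⟩
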